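/- arXiv:2410.12072 — 2 statements merged into one kernel-verified Lean document; each statement's English description precedes it below -/
import Mathlib

section
/- The function g is concave on [a,b]: for all x, y ∈ [a,b] and λ ∈ [0,1], g(λx + (1−λ)y) ≥ λ g(x) + (1−λ) g(y). -/
open MeasureTheory Set

theorem bm_one_compact (A B C : Set ℝ) (hA : IsCompact A) (hB : IsCompact B)
    (hAn : A.Nonempty) (hBn : B.Nonempty)
    (h : ∀ a ∈ A, ∀ b ∈ B, a + b ∈ C) : volume A + volume B ≤ volume C := by
  obtain ⟨p, hp, hpmax⟩ := hA.exists_isGreatest hAn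
  obtain ⟨q, hq, hqmin⟩ := hB.exists_isLeast hBn
  have h1 : volume ((fun x => x + (-q)) ⁻¹' A) = volume A := measure_preimage_add_right _ _ _
  have h2 : volume ((fun x => x + (-p)) ⁻¹' B) = volume B := measure_preimage_add_right _ _ _
  rw [← h1, ← h2, ← measure_union_add_inter]
  · have h3 : volume ((fun x => x + (-q)) ⁻¹' A ∩ (fun x => x + (-p)) ⁻¹' B) = 0 := by
      refine measure_mono_null (t := {p + q}) ?_ (by simp)
      rintro x ⟨hx1, hx2⟩
      have := hpmax hx1
      have := hqmin hx2
      simp only [mem_singleton_iff] at *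
      linarith
    rw [h3, add_zero]
    apply measure_mono
    rintro x (hx | hx)
    · have := h _ hx q hq
      simpa using this
    · have := h p hp _ hx
      simpa using this
  · exact (hB.measurableSet).preimage (by fun_prop)

theorem bm_one (A B C : Set ℝ) (hA : MeasurableSet A) (hB : MeasurableSet B)
    (hAn : A.Nonempty) (hBn : B.Nonempty)
    (h : ∀ a ∈ A, ∀ b ∈ B, a + b ∈ C) : volume A + volume B ≤ volume C := by
  have key : ∀ S : Set ℝ, MeasurableSet S → S.Nonempty → ∀ r < volume S,
      ∃ K ⊆ S, IsCompact K ∧ K.Nonempty ∧ r < volume K := by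
    intro S hS hSn r hr
    obtain ⟨K, hK, hKc, hKr⟩ := hS.exists_lt_isCompact hr
    refine ⟨K, hK, hKc, ?_, hKr⟩
    rw [nonempty_iff_ne_empty]
    rintro rfl
    simp at hKr
  have key2 : ∀ S : Set ℝ, MeasurableSet S → S.Nonempty → ∀ c : ENNReal, ∀ D : ENNReal,
      (∀ K ⊆ S, IsCompact K → K.Nonempty → volume K + c ≤ D) → volume S + c ≤ D := by
    intro S hS hSn c D H
    rcases eq_or_ne (volume S) 0 with h0 | h0
    · obtain ⟨s, hs⟩ := hSn
      have := H {s} (by simpa using hs) isCompact_singleton (singleton_nonempty s)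
      simpa [h0] using this
    · have : ∀ r < volume S, r + c ≤ D := by
        intro r hr
        obtain ⟨K, h1, h2, h3, h4⟩ := key S hS hSn r hr
        exact le_trans (by gcongr) (H K h1 h2 h3)
      refine le_of_forall_lt fun e he => ?_
      obtain ⟨r, hr, c', hc', hh⟩ : ∃ r < volume S, ∃ c' ≤ c, e < r + c' := by
        by_contra! hcon
        have : ∀ r < volume S, r + c ≤ e := fun r hr => hcon r hr c le_rfl
        have h5 : volume S ≤ e - c := by
          refine le_of_forall_lt fun r hr => ?_
          obtain ⟨r', hr1, hr2⟩ := exists_between hr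
          refine lt_of_lt_of_le hr1 ?_
          have hcc : c ≠ ⊤ := by
            rintro rfl
            have := this r' hr2
            simp at this
            subst this
            simp at he
          exact ENNReal.le_sub_of_add_le_right hcc (this r' hr2)
        have hce : c ≤ e := le_trans le_add_self (this 0 (pos_iff_ne_zero.2 h0))
        have : volume S + c ≤ e := by
          calc _ ≤ e - c + c := by gcongr
            _ = e := tsub_add_cancel_of_le hce
        exact absurd he (not_lt.2 this)
      exact lt_of_lt_of_le hh (le_trans (by gcongr) (this r hr))
  apply key2 A hA hAn
  intro K hK hKc hKn
  rw [add_comm]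
  apply key2 B hB hBn
  intro L hL hLc hLn
  rw [add_comm]
  exact bm_one_compact K L C hKc hLc hKn hLn fun a ha b hb => h a (hK ha) b (hL hb)

theorem bm_one_weighted (θ : ℝ) (h0 : 0 < θ) (h1 : θ < 1) (A B C : Set ℝ)
    (hA : MeasurableSet A) (hB : MeasurableSet B)
    (hAn : A.Nonempty) (hBn : B.Nonempty)
    (h : ∀ a ∈ A, ∀ b ∈ B, θ * a + (1 - θ) * b ∈ C) :
    ENNReal.ofReal θ * volume A + ENNReal.ofReal (1 - θ) * volume B ≤ volume C := by
  have e1 := Measure.addHaar_smul (volume : Measure ℝ) θ A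
  have e2 := Measure.addHaar_smul (volume : Measure ℝ) (1 - θ) B
  simp only [Module.finrank_self, pow_one, abs_of_pos h0, abs_of_pos (sub_pos.2 h1)] at e1 e2
  rw [← e1, ← e2]
  apply bm_one
  · exact hA.const_smul₀ θ
  · exact hB.const_smul₀ _
  · exact hAn.smul_set
  · exact hBn.smul_set
  · rintro _ ⟨a, ha, rfl⟩ _ ⟨b, hb, rfl⟩
    exact h a ha b hb

theorem layer (f : ℝ → ENNReal) (hf : Measurable f) (h1 : ∀ x, f x ≤ 1) :
    ∫⁻ x, f x = ∫⁻ t in Ioo (0:ℝ) 1, volume {x | ENNReal.ofReal t < f x} := by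
  have hfin : ∀ x, f x ≠ ⊤ := fun x => ne_top_of_le_ne_top (by simp) (h1 x)
  have e1 : ∫⁻ x, f x = ∫⁻ x, ENNReal.ofReal (f x).toReal := by
    congr 1; ext x; rw [ENNReal.ofReal_toReal (hfin x)]
  rw [e1, lintegral_eq_lintegral_meas_lt volume (Filter.Eventually.of_forall fun x => by simp)
    hf.ennreal_toReal.aemeasurable, ← Ioo_union_Ici_eq_Ioi zero_lt_one,
    lintegral_union measurableSet_Ici]
  · have : ∫⁻ t in Ici (1:ℝ), volume {a | t < (f a).toReal} = 0 := by
      rw [setLIntegral_congr_fun (g := fun _ => 0) measurableSet_Ici]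
      · simp
      · intro t ht
        have : {a | t < (f a).toReal} = ∅ := by
          ext x
          simp only [mem_ofPred_eq, mem_empty_iff_false, iff_false, not_lt]
          refine le_trans ?_ ht
          simpa using ENNReal.toReal_mono (by simp) (h1 x)
        simp [this]
    rw [this, add_zero]
    apply setLIntegral_congr_fun measurableSet_Ioo
    intro t ht
    simp only
    congr 1
    ext x
    simp only [mem_ofPred_eq]
    rw [ENNReal.ofReal_lt_iff_lt_toReal ht.1.le (hfin x)]
  · rw [Set.disjoint_left]
    intro x hx hx'
    exact absurd hx.2 (not_lt.2 hx')

theorem ennreal_amgm (θ : ℝ) (h0 : 0 < θ) (h1 : θ < 1) (x y : ENNReal) :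
    x ^ θ * y ^ (1 - θ) ≤ ENNReal.ofReal θ * x + ENNReal.ofReal (1 - θ) * y := by
  rcases eq_or_ne x ⊤ with rfl | hx
  · rw [ENNReal.mul_top (by simpa using h0)]; simp
  rcases eq_or_ne y ⊤ with rfl | hy
  · rw [ENNReal.mul_top (by simpa using h1)]; simp
  lift x to NNReal using hx
  lift y to NNReal using hy
  have := NNReal.geom_mean_le_arith_mean2_weighted ⟨θ, h0.le⟩ ⟨1 - θ, (sub_pos.2 h1).le⟩ x y
    (NNReal.eq (show θ + (1 - θ) = 1 by ring))
  rw [← ENNReal.coe_rpow_of_nonneg _ h0.le, ← ENNReal.coe_rpow_of_nonneg _ (sub_pos.2 h1).le,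
    ENNReal.ofReal_eq_coe_nnreal h0.le, ENNReal.ofReal_eq_coe_nnreal (sub_pos.2 h1).le]
  exact_mod_cast this

theorem pl_norm (θ : ℝ) (h0 : 0 < θ) (h1 : θ < 1) (f g h : ℝ → ENNReal)
    (hf : Measurable f) (hg : Measurable g) (hh : Measurable h)
    (sf : ⨆ x, f x = 1) (sg : ⨆ x, g x = 1)
    (H : ∀ x y, f x ^ θ * g y ^ (1 - θ) ≤ h (θ * x + (1 - θ) * y)) :
    (∫⁻ x, f x) ^ θ * (∫⁻ x, g x) ^ (1 - θ) ≤ ∫⁻ x, h x := by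
  refine (ennreal_amgm θ h0 h1 _ _).trans ?_
  have e3 : ∫⁻ x, min (h x) 1 ≤ ∫⁻ x, h x := lintegral_mono fun x => min_le_left _ _
  refine le_trans ?_ e3
  rw [layer f hf fun x => sf ▸ le_iSup f x, layer g hg fun x => sg ▸ le_iSup g x,
    layer _ (hh.min measurable_const) fun x => min_le_right _ _,
    ← lintegral_const_mul' _ _ (by simp), ← lintegral_const_mul' _ _ (by simp),
    ← lintegral_add_left']
  · apply setLIntegral_mono' measurableSet_Ioo
    intro t ht
    have ht1 : ENNReal.ofReal t < 1 := by simpa using ht.2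
    apply bm_one_weighted θ h0 h1
    · exact measurableSet_lt measurable_const hf
    · exact measurableSet_lt measurable_const hg
    · exact lt_iSup_iff.1 (sf ▸ ht1)
    · exact lt_iSup_iff.1 (sg ▸ ht1)
    · intro x hx y hy
      simp only [mem_ofPred_eq] at *
      refine lt_min (lt_of_lt_of_le ?_ (H x y)) ht1
      have : ENNReal.ofReal t = ENNReal.ofReal t ^ θ * ENNReal.ofReal t ^ (1 - θ) := by
        rw [← ENNReal.rpow_add _ _ (by simpa using ht.1) (by simp)]
        simp
      rw [this]
      exact ENNReal.mul_lt_mul (ENNReal.rpow_lt_rpow hx h0) (ENNReal.rpow_lt_rpow hy (sub_pos.2 h1))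
  · refine (Measurable.const_mul ?_ _).aemeasurable
    apply Antitone.measurable
    intro s t hst
    apply measure_mono
    intro x hx
    exact lt_of_le_of_lt (ENNReal.ofReal_le_ofReal hst) hx

theorem pl_bdd (θ : ℝ) (h0 : 0 < θ) (h1 : θ < 1) (f g h : ℝ → ENNReal)
    (hf : Measurable f) (hg : Measurable g) (hh : Measurable h)
    (sf : ⨆ x, f x ≠ ⊤) (sg : ⨆ x, g x ≠ ⊤)
    (H : ∀ x y, f x ^ θ * g y ^ (1 - θ) ≤ h (θ * x + (1 - θ) * y)) :
    (∫⁻ x, f x) ^ θ * (∫⁻ x, g x) ^ (1 - θ) ≤ ∫⁻ x, h x := by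
  have h1' : 0 < 1 - θ := sub_pos.2 h1
  set a := ⨆ x, f x with ha
  set b := ⨆ x, g x with hb
  rcases eq_or_ne a 0 with a0 | a0
  · have : ∀ x, f x = 0 := by simpa [a0] using ha.symm
    simp [this, h0]
  rcases eq_or_ne b 0 with b0 | b0
  · have : ∀ x, g x = 0 := by simpa [b0] using hb.symm
    simp [this, h1]
  have := pl_norm θ h0 h1 (fun x => a⁻¹ * f x) (fun x => b⁻¹ * g x)
    (fun x => (a⁻¹ ^ θ * b⁻¹ ^ (1 - θ)) * h x)
    (hf.const_mul _) (hg.const_mul _) (hh.const_mul _)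
    (by rw [← ENNReal.mul_iSup, ← ha, ENNReal.inv_mul_cancel a0 sf])
    (by rw [← ENNReal.mul_iSup, ← hb, ENNReal.inv_mul_cancel b0 sg])
    (fun x y => by
      rw [ENNReal.mul_rpow_of_nonneg _ _ h0.le, ENNReal.mul_rpow_of_nonneg _ _ h1'.le,
        mul_mul_mul_comm]
      gcongr
      exact H x y)
  rw [lintegral_const_mul _ hf, lintegral_const_mul _ hg, lintegral_const_mul _ hh,
    ENNReal.mul_rpow_of_nonneg _ _ h0.le, ENNReal.mul_rpow_of_nonneg _ _ h1'.le,
    mul_mul_mul_comm] at this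
  have a1 : a⁻¹ ≠ 0 := ENNReal.inv_ne_zero.2 sf
  have b1 : b⁻¹ ≠ 0 := ENNReal.inv_ne_zero.2 sg
  have a2 : a⁻¹ ≠ ⊤ := ENNReal.inv_ne_top.2 a0
  have b2 : b⁻¹ ≠ ⊤ := ENNReal.inv_ne_top.2 b0
  refine (ENNReal.mul_le_mul_iff_right ?_ ?_).1 this
  · exact mul_ne_zero (ENNReal.rpow_pos (pos_iff_ne_zero.2 a1) a2).ne'
      (ENNReal.rpow_pos (pos_iff_ne_zero.2 b1) b2).ne'
  · exact ENNReal.mul_ne_top (ENNReal.rpow_ne_top_of_nonneg h0.le a2)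
      (ENNReal.rpow_ne_top_of_nonneg h1'.le b2)

theorem trunc_tendsto (f : ℝ → ENNReal) (hf : Measurable f) :
    Filter.Tendsto (fun n : ℕ => ∫⁻ x, min (f x) n) Filter.atTop (nhds (∫⁻ x, f x)) := by
  apply lintegral_tendsto_of_tendsto_of_monotone
  · intro n
    exact (hf.min measurable_const).aemeasurable
  · refine Filter.Eventually.of_forall fun x m n hmn => ?_
    exact min_le_min_left _ (by exact_mod_cast hmn)
  · refine Filter.Eventually.of_forall fun x => ?_
    have := (tendsto_const_nhds (x := f x)).min ENNReal.tendsto_nat_nhds_top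
    simpa using this

theorem pl_one (θ : ℝ) (h0 : 0 < θ) (h1 : θ < 1) (f g h : ℝ → ENNReal)
    (hf : Measurable f) (hg : Measurable g) (hh : Measurable h)
    (H : ∀ x y, f x ^ θ * g y ^ (1 - θ) ≤ h (θ * x + (1 - θ) * y)) :
    (∫⁻ x, f x) ^ θ * (∫⁻ x, g x) ^ (1 - θ) ≤ ∫⁻ x, h x := by
  have h1' : 0 < 1 - θ := sub_pos.2 h1
  rcases eq_or_ne (∫⁻ x, f x) 0 with a0 | a0
  · simp [a0, h0]
  rcases eq_or_ne (∫⁻ x, g x) 0 with b0 | b0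
  · simp [b0, h1]
  have t1 := (ENNReal.continuous_rpow_const (y := θ)).tendsto _ |>.comp (trunc_tendsto f hf)
  have t2 := (ENNReal.continuous_rpow_const (y := 1 - θ)).tendsto _ |>.comp (trunc_tendsto g hg)
  have t3 := ENNReal.Tendsto.mul t1 (Or.inl (by simp [a0, h0.le, h0.not_gt])) t2
    (Or.inl (by simp [b0, h1.le, h1.not_gt]))
  refine le_of_tendsto' t3 fun n => ?_
  apply pl_bdd θ h0 h1 _ _ h (hf.min measurable_const) (hg.min measurable_const) hh
  · exact ne_top_of_le_ne_top (ENNReal.natCast_ne_top n) (iSup_le fun x => min_le_right _ _)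
  · exact ne_top_of_le_ne_top (ENNReal.natCast_ne_top n) (iSup_le fun x => min_le_right _ _)
  · intro x y
    refine le_trans ?_ (H x y)
    gcongr <;> exact min_le_left _ _

theorem lint_succ (k : ℕ) (f : (Fin (k+1) → ℝ) → ENNReal) (hf : Measurable f) :
    ∫⁻ x, f x = ∫⁻ t : ℝ, ∫⁻ y : Fin k → ℝ, f (Fin.cons t y) := by
  have hm := volume_preserving_piFinSuccAbove (fun _ : Fin (k+1) => ℝ) 0
  have e := MeasurePreserving.lintegral_map_equiv f
    (MeasurableEquiv.piFinSuccAbove (fun _ : Fin (k+1) => ℝ) 0).symm hm.symm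
  rw [e]
  rw [Measure.volume_eq_prod, lintegral_prod]
  · simp [Fin.consEquiv]
  · exact (hf.comp (MeasurableEquiv.measurable _)).aemeasurable

theorem meas_cons (k : ℕ) : Measurable fun p : ℝ × (Fin k → ℝ) =>
    (Fin.cons p.1 p.2 : Fin (k+1) → ℝ) := by
  rw [measurable_pi_iff]
  intro i
  refine Fin.cases ?_ (fun j => ?_) i
  · simpa using measurable_fst
  · simp only [Fin.cons_succ]; fun_prop

theorem pl (θ : ℝ) (h0 : 0 < θ) (h1 : θ < 1) (k : ℕ) : ∀ (f g h : (Fin k → ℝ) → ENNReal)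
    (_ : Measurable f) (_ : Measurable g) (_ : Measurable h)
    (_ : ∀ x y, f x ^ θ * g y ^ (1 - θ) ≤ h (θ • x + (1 - θ) • y)),
    (∫⁻ x, f x) ^ θ * (∫⁻ x, g x) ^ (1 - θ) ≤ ∫⁻ x, h x := by
  induction k with
  | zero =>
    intro f g h hf hg hh H
    have e : ∀ F : (Fin 0 → ℝ) → ENNReal, ∫⁻ x, F x = F default := by
      intro F
      rw [lintegral_unique]
      simp [volume_pi]
      exact congrArg F (Subsingleton.elim _ _)
    rw [e, e, e]
    convert H default default
  | succ k ih =>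
    intro f g h hf hg hh H
    rw [lint_succ k f hf, lint_succ k g hg, lint_succ k h hh]
    have hc := meas_cons k
    apply pl_one θ h0 h1
    · exact (hf.comp hc).lintegral_prod_right'
    · exact (hg.comp hc).lintegral_prod_right'
    · exact (hh.comp hc).lintegral_prod_right'
    · intro s t
      apply ih
      · exact (hf.comp hc).comp measurable_prodMk_left
      · exact (hg.comp hc).comp measurable_prodMk_left
      · exact (hh.comp hc).comp measurable_prodMk_left
      · intro x y
        refine (H _ _).trans (le_of_eq ?_)
        congr 1
        ext i
        refine Fin.cases ?_ (fun j => ?_) i <;> simp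

theorem bm_mult (θ : ℝ) (h0 : 0 < θ) (h1 : θ < 1) (k : ℕ)
    (A B C : Set (EuclideanSpace ℝ (Fin k)))
    (hA : MeasurableSet A) (hB : MeasurableSet B) (hC : MeasurableSet C)
    (H : ∀ x ∈ A, ∀ y ∈ B, θ • x + (1 - θ) • y ∈ C) :
    (volume A) ^ θ * (volume B) ^ (1 - θ) ≤ volume C := by
  have hm := EuclideanSpace.volume_preserving_symm_measurableEquiv_toLp (Fin k)
  have hme := (MeasurableEquiv.toLp 2 (Fin k → ℝ)).measurable
  have e : ∀ S : Set (EuclideanSpace ℝ (Fin k)), MeasurableSet S → volume S =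
      ∫⁻ x, (S.indicator (fun _ => (1:ENNReal))) (MeasurableEquiv.toLp 2 (Fin k → ℝ) x) := by
    intro S hS
    have e2 := MeasurePreserving.lintegral_map_equiv (S.indicator (fun _ => (1:ENNReal))) _ hm.symm
    rw [lintegral_indicator hS] at e2
    simpa using e2
  rw [e A hA, e B hB, e C hC]
  apply pl θ h0 h1 k
  · exact (measurable_const.indicator hA).comp hme
  · exact (measurable_const.indicator hB).comp hme
  · exact (measurable_const.indicator hC).comp hme
  · intro x y
    change (A.indicator (fun _ => (1:ENNReal)) (WithLp.toLp 2 x)) ^ θ *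
      (B.indicator (fun _ => (1:ENNReal)) (WithLp.toLp 2 y)) ^ (1 - θ) ≤
      C.indicator (fun _ => (1:ENNReal)) (θ • WithLp.toLp 2 x + (1 - θ) • WithLp.toLp 2 y)
    by_cases hx : WithLp.toLp 2 x ∈ A
    · by_cases hy : WithLp.toLp 2 y ∈ B
      · have h3 := H _ hx _ hy
        rw [indicator_of_mem hx, indicator_of_mem hy, indicator_of_mem h3]
        simp
      · rw [indicator_of_notMem hy, ENNReal.zero_rpow_of_pos (sub_pos.2 h1)]
        simp
    · rw [indicator_of_notMem hx, ENNReal.zero_rpow_of_pos h0]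
      simp

open Pointwise in
theorem vol_smul_real (k : ℕ) (l : ℝ) (hl : 0 ≤ l) (B : Set (EuclideanSpace ℝ (Fin k))) :
    (volume (l • B)).toReal = l ^ k * (volume B).toReal := by
  rw [Measure.addHaar_smul]
  simp [ENNReal.toReal_mul, abs_of_nonneg hl, hl]

theorem root_pow (k : ℕ) (hk : 0 < k) (s b c : ℝ) (hs : 0 ≤ s) (hb : 0 ≤ b)
    (h : s ^ k * b ≤ c) : s * b ^ ((k:ℝ)⁻¹) ≤ c ^ ((k:ℝ)⁻¹) := by
  have : s * b ^ ((k:ℝ)⁻¹) = (s ^ k * b) ^ ((k:ℝ)⁻¹) := by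
    rw [Real.mul_rpow (by positivity) hb, Real.pow_rpow_inv_natCast hs hk.ne']
  rw [this]
  exact Real.rpow_le_rpow (by positivity) h (by positivity)

open Pointwise in
theorem bm_degen (k : ℕ) (hk : 0 < k) (l : ℝ) (hl : 0 ≤ l)
    (B C : Set (EuclideanSpace ℝ (Fin k))) (v : EuclideanSpace ℝ (Fin k))
    (hC : volume C ≠ ⊤) (H : ∀ y ∈ B, v + l • y ∈ C) :
    l * (volume B).toReal ^ ((k:ℝ)⁻¹) ≤ (volume C).toReal ^ ((k:ℝ)⁻¹) := by
  have e : volume (l • B) ≤ volume C := by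
    rw [← measure_preimage_add volume v C]
    apply measure_mono
    rintro _ ⟨y, hy, rfl⟩
    exact H y hy
  apply root_pow k hk _ _ _ hl ENNReal.toReal_nonneg
  rw [← vol_smul_real k l hl]
  exact ENNReal.toReal_mono hC e

open Pointwise in
theorem bm_add (k : ℕ) (hk : 0 < k) (l : ℝ) (hl : 0 ≤ l) (hl1 : l ≤ 1)
    (A B C : Set (EuclideanSpace ℝ (Fin k)))
    (hA : IsCompact A) (hB : IsCompact B) (hC : IsCompact C)
    (hAn : A.Nonempty) (hBn : B.Nonempty)
    (H : ∀ x ∈ A, ∀ y ∈ B, l • x + (1 - l) • y ∈ C) :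
    l * (volume A).toReal ^ ((k:ℝ)⁻¹) + (1 - l) * (volume B).toReal ^ ((k:ℝ)⁻¹)
      ≤ (volume C).toReal ^ ((k:ℝ)⁻¹) := by
  have hl' : 0 ≤ 1 - l := sub_nonneg.2 hl1
  obtain ⟨p, hp⟩ := hAn
  obtain ⟨q, hq⟩ := hBn
  have d1 := bm_degen k hk (1 - l) hl' B C (l • p) hC.measure_lt_top.ne (fun y hy => H p hp y hy)
  have d2 := bm_degen k hk l hl A C ((1 - l) • q) hC.measure_lt_top.ne
    (fun x hx => by rw [add_comm]; exact H x hx q hq)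
  set α := (volume A).toReal ^ ((k:ℝ)⁻¹) with hα
  set β := (volume B).toReal ^ ((k:ℝ)⁻¹) with hβ
  have α0 : 0 ≤ α := by positivity
  have β0 : 0 ≤ β := by positivity
  have αk : α ^ k = (volume A).toReal := Real.rpow_inv_natCast_pow ENNReal.toReal_nonneg hk.ne'
  have βk : β ^ k = (volume B).toReal := Real.rpow_inv_natCast_pow ENNReal.toReal_nonneg hk.ne'
  rcases (mul_nonneg hl α0).eq_or_lt with z | z
  · rw [← z, zero_add]; exact d1
  rcases (mul_nonneg hl' β0).eq_or_lt with w | w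
  · rw [← w, add_zero]; exact d2
  have αp : 0 < α := lt_of_le_of_ne α0 (by rintro h; simp [← h] at z)
  have βp : 0 < β := lt_of_le_of_ne β0 (by rintro h; simp [← h] at w)
  set s := l * α + (1 - l) * β with hs
  have sp : 0 < s := by positivity
  have vA : volume (α⁻¹ • A) = 1 := by
    rw [← ENNReal.toReal_eq_one_iff, vol_smul_real k _ (by positivity), ← αk, ← mul_pow,
      inv_mul_cancel₀ αp.ne', one_pow]
  have vB : volume (β⁻¹ • B) = 1 := by
    rw [← ENNReal.toReal_eq_one_iff, vol_smul_real k _ (by positivity), ← βk, ← mul_pow,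
      inv_mul_cancel₀ βp.ne', one_pow]
  have θ1 : 1 - l * α / s = (1 - l) * β / s := by field_simp; rw [hs]; ring
  have main := bm_mult (l * α / s) (by positivity) (by
      have : 0 < (1 - l) * β / s := by positivity
      linarith) k (α⁻¹ • A) (β⁻¹ • B) (s⁻¹ • C)
    (hA.smul _).measurableSet (hB.smul _).measurableSet (hC.smul _).measurableSet (by
      rintro _ ⟨x, hx, rfl⟩ _ ⟨y, hy, rfl⟩
      refine ⟨_, H x hx y hy, ?_⟩
      rw [θ1]
      simp only [smul_add, smul_smul]
      congr 2 <;> field_simp)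
  rw [vA, vB, ENNReal.one_rpow, ENNReal.one_rpow, one_mul] at main
  have m2 := ENNReal.toReal_mono (hC.smul _).measure_lt_top.ne main
  rw [vol_smul_real k _ (by positivity), ENNReal.toReal_one, inv_pow] at m2
  have m3 : s ^ k * 1 ≤ (volume C).toReal := by
    rw [mul_one]
    have := mul_le_mul_of_nonneg_left m2 (pow_pos sp k).le
    rwa [mul_one, mul_inv_cancel_left₀ (pow_pos sp k).ne'] at this
  simpa using root_pow k hk s 1 _ sp.le zero_le_one m3

theorem g_concave (n : ℕ) (hn : 2 ≤ n)
    (K : Set (ℝ × EuclideanSpace ℝ (Fin (n - 1))))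
    (hKcomp : IsCompact K) (hKconv : Convex ℝ K) (hKpos : 0 < volume K)
    (a b : ℝ)
    (ha : IsLeast (Prod.fst '' K) a) (hb : IsGreatest (Prod.fst '' K) b)
    (g : ℝ → ℝ)
    (hg : ∀ x ∈ Icc a b,
      g x = (volume {y : EuclideanSpace ℝ (Fin (n - 1)) | (x, y) ∈ K}).toReal
              ^ (((n:ℝ) - 1)⁻¹)) :
    ∀ x ∈ Icc a b, ∀ y ∈ Icc a b, ∀ l ∈ Icc (0:ℝ) 1,
      l * g x + (1 - l) * g y ≤ g (l * x + (1 - l) * y) := by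
  intro x hx y hy l hl
  have hl' : 0 ≤ 1 - l := sub_nonneg.2 hl.2
  have hz : l * x + (1 - l) * y ∈ Icc a b := by
    have := convex_Icc a b hx hy hl.1 hl' (by ring)
    simpa using this
  rw [hg x hx, hg y hy, hg _ hz]
  have hcast : ((n:ℝ) - 1) = ((n - 1 : ℕ) : ℝ) := by
    rw [Nat.cast_sub (by omega)]; simp
  rw [hcast]
  have comp : ∀ t : ℝ, IsCompact {y : EuclideanSpace ℝ (Fin (n - 1)) | (t, y) ∈ K} := by
    intro t
    have : {y : EuclideanSpace ℝ (Fin (n - 1)) | (t, y) ∈ K} =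
        Prod.snd '' (K ∩ Prod.fst ⁻¹' {t}) := by
      ext w
      constructor
      · intro hw
        exact ⟨(t, w), ⟨hw, rfl⟩, rfl⟩
      · rintro ⟨⟨t', w'⟩, ⟨h1, h2⟩, rfl⟩
        obtain rfl : t' = t := h2
        exact h1
    rw [this]
    exact (hKcomp.inter_right (isClosed_singleton.preimage continuous_fst)).image continuous_snd
  have ne : ∀ t ∈ Icc a b, {y : EuclideanSpace ℝ (Fin (n - 1)) | (t, y) ∈ K}.Nonempty := by
    intro t ht
    have hc : Convex ℝ (Prod.fst '' K) :=
      hKconv.linear_image (LinearMap.fst ℝ ℝ (EuclideanSpace ℝ (Fin (n - 1))))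
    obtain ⟨⟨t', w⟩, hw, rfl⟩ := hc.ordConnected.out ha.1 hb.1 ht
    exact ⟨w, hw⟩
  apply bm_add (n - 1) (by omega) l hl.1 hl.2 _ _ _ (comp x) (comp y) (comp _) (ne x hx) (ne y hy)
  intro u hu v hv
  have := hKconv hu hv hl.1 hl' (by ring)
  simpa using this
end

section
/- Under hypotheses (H1)–(H4), one has b' ≤ 3n². -/
section helpers
open MeasureTheory Set
open scoped Pointwise

/-- One-dimensional Brunn-Minkowski for compact sets. -/
lemma bm1_compact (A B C : Set ℝ) (hA : IsCompact A) (hB : IsCompact B)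
    (hA0 : A.Nonempty) (hB0 : B.Nonempty)
    (hC : ∀ x ∈ A, ∀ y ∈ B, x + y ∈ C) : volume A + volume B ≤ volume C := by
  obtain ⟨p, hp, hpm⟩ := hA.exists_isGreatest hA0
  obtain ⟨q, hq, hqm⟩ := hB.exists_isLeast hB0
  have h1 : volume ((fun x => x + q) '' A) = volume A := by
    simp
  have h2 : volume ((fun x => p + x) '' B) = volume B := by
    simp
  have hd : AEDisjoint volume ((fun x => x + q) '' A) ((fun x => p + x) '' B) := by
    refine measure_mono_null (t := {p + q}) ?_ (by simp)
    rintro z ⟨⟨x, hx, rfl⟩, ⟨y, hy, hxy⟩⟩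
    have := hpm hx
    have := hqm hy
    simp only [mem_singleton_iff] at *
    linarith
  have hm : NullMeasurableSet ((fun x => p + x) '' B) volume :=
    ((hB.image (by fun_prop)).measurableSet).nullMeasurableSet
  rw [← h1, ← h2, ← measure_union₀ hm hd]
  apply measure_mono
  rintro z (⟨x, hx, rfl⟩ | ⟨x, hx, rfl⟩)
  · exact hC _ hx _ hq
  · exact hC _ hp _ hx

lemma bm1 (A B C : Set ℝ) (hA : MeasurableSet A) (hB : MeasurableSet B)
    (hA0 : A.Nonempty) (hB0 : B.Nonempty)
    (hC : ∀ x ∈ A, ∀ y ∈ B, x + y ∈ C) : volume A + volume B ≤ volume C := by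
  have key : ∀ K, K ⊆ A → IsCompact K → ∀ L, L ⊆ B → IsCompact L →
      volume K + volume L ≤ volume C := by
    intro K hK hKc L hL hLc
    obtain ⟨p, hp⟩ := hA0
    obtain ⟨q, hq⟩ := hB0
    calc volume K + volume L ≤ volume (insert p K) + volume (insert q L) := by
          gcongr <;> exact subset_insert _ _
      _ ≤ volume C := by
          refine bm1_compact _ _ _ (hKc.insert p) (hLc.insert q) (insert_nonempty _ _)
            (insert_nonempty _ _) ?_
          intro x hx y hy
          exact hC _ (insert_subset hp hK hx) _ (insert_subset hq hL hy)
  by_contra! hlt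
  have : Nonempty {K // K ⊆ A} := ⟨⟨∅, empty_subset _⟩⟩
  have : Nonempty {K // K ⊆ B} := ⟨⟨∅, empty_subset _⟩⟩
  have h1 : ∀ L, L ⊆ B → IsCompact L → volume A + volume L ≤ volume C := by
    intro L hL hLc
    rw [hA.measure_eq_iSup_isCompact]
    rw [iSup_subtype', ENNReal.iSup_add]
    refine iSup_le fun K => ?_
    by_cases hc : IsCompact (K : Set ℝ)
    · simpa [hc] using key K K.2 hc L hL hLc
    · simpa [hc] using key ∅ (empty_subset _) isCompact_empty L hL hLc
  refine absurd ?_ (not_le.2 hlt)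
  rw [hB.measure_eq_iSup_isCompact]
  rw [iSup_subtype', ENNReal.add_iSup]
  refine iSup_le fun K => ?_
  by_cases hc : IsCompact (K : Set ℝ)
  · simpa [hc] using h1 K K.2 hc
  · simpa [hc] using h1 ∅ (empty_subset _) isCompact_empty

lemma bm1_scaled (a b : ℝ) (ha : 0 < a) (hb : 0 < b)
    (A B C : Set ℝ) (hA : MeasurableSet A) (hB : MeasurableSet B)
    (hA0 : A.Nonempty) (hB0 : B.Nonempty)
    (hC : ∀ x ∈ A, ∀ y ∈ B, a * x + b * y ∈ C) :
    ENNReal.ofReal a * volume A + ENNReal.ofReal b * volume B ≤ volume C := by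
  have h1 := bm1 (a • A) (b • B) C (hA.const_smul₀ a) (hB.const_smul₀ b)
    (hA0.smul_set) (hB0.smul_set) (by
      rintro _ ⟨x, hx, rfl⟩ _ ⟨y, hy, rfl⟩
      exact hC x hx y hy)
  simpa [Measure.addHaar_smul, abs_of_pos ha, abs_of_pos hb] using h1

lemma amgm_ennreal (a b : ℝ) (ha : 0 < a) (hb : 0 < b) (hab : a + b = 1) (X Y : ENNReal) :
    X ^ a * Y ^ b ≤ ENNReal.ofReal a * X + ENNReal.ofReal b * Y := by
  by_cases hX : X = ⊤
  · simp [hX, ENNReal.mul_top, ha]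
  by_cases hY : Y = ⊤
  · simp [hY, ENNReal.mul_top, hb]
  lift X to NNReal using hX
  lift Y to NNReal using hY
  have h := NNReal.geom_mean_le_arith_mean2_weighted a.toNNReal b.toNNReal X Y
    (by rw [← Real.toNNReal_add ha.le hb.le, hab]; simp)
  rw [Real.coe_toNNReal _ ha.le, Real.coe_toNNReal _ hb.le] at h
  rw [← ENNReal.coe_rpow_of_nonneg _ ha.le, ← ENNReal.coe_rpow_of_nonneg _ hb.le]
  simp only [ENNReal.ofReal]
  exact_mod_cast h

lemma pl1_norm (a b : ℝ) (ha : 0 < a) (hb : 0 < b) (hab : a + b = 1)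
    (f g h : ℝ → ENNReal) (hf : Measurable f) (hg : Measurable g) (hh : Measurable h)
    (hf1 : ∀ x, f x ≤ 1) (hg1 : ∀ x, g x ≤ 1)
    (hfs : ∀ t < 1, ∃ x, t < f x) (hgs : ∀ t < 1, ∃ x, t < g x)
    (H : ∀ x y, f x ^ a * g y ^ b ≤ h (a * x + b * y)) :
    ENNReal.ofReal a * (∫⁻ x, f x) + ENNReal.ofReal b * (∫⁻ x, g x) ≤ ∫⁻ x, h x := by
  have layer : ∀ u : ℝ → ENNReal, Measurable u → (∀ x, u x ≤ 1) →
      ∫⁻ x, u x = ∫⁻ t in Ioi (0:ℝ), volume {x | ENNReal.ofReal t < u x} := by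
    intro u hu hu1
    have hfin : ∀ x, u x ≠ ⊤ := fun x => ne_top_of_le_ne_top ENNReal.one_ne_top (hu1 x)
    have := lintegral_eq_lintegral_meas_lt (f := fun x => (u x).toReal) volume
      (Filter.Eventually.of_forall fun x => ENNReal.toReal_nonneg) hu.ennreal_toReal.aemeasurable
    rw [show (∫⁻ x, u x) = ∫⁻ x, ENNReal.ofReal ((u x).toReal) by
      simp [ENNReal.ofReal_toReal (hfin _)], this]
    refine setLIntegral_congr_fun measurableSet_Ioi fun t ht => ?_
    congr 1
    ext x
    simp only [mem_ofPred_eq]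
    rw [ENNReal.ofReal_lt_iff_lt_toReal (le_of_lt ht) (hfin x)]
  have hle : ∫⁻ x, min (h x) 1 ≤ ∫⁻ x, h x := lintegral_mono fun x => min_le_left _ _
  refine le_trans ?_ hle
  rw [layer f hf hf1, layer g hg hg1,
    layer (fun x => min (h x) 1) (hh.min measurable_const) (fun x => min_le_right _ _)]
  refine le_trans (add_le_add (lintegral_const_mul_le _ _) (lintegral_const_mul_le _ _)) ?_
  refine le_trans (le_lintegral_add _ _) ?_
  refine setLIntegral_mono' measurableSet_Ioi fun t ht => ?_
  by_cases ht1 : ENNReal.ofReal t < 1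
  · refine bm1_scaled a b ha hb _ _ _ (measurableSet_lt measurable_const hf)
      (measurableSet_lt measurable_const hg) (hfs _ ht1) (hgs _ ht1) ?_
    intro x hx y hy
    refine lt_min ?_ ht1
    refine lt_of_lt_of_le ?_ (H x y)
    have : ENNReal.ofReal t = ENNReal.ofReal t ^ a * ENNReal.ofReal t ^ b := by
      rw [← ENNReal.rpow_add_of_nonneg _ _ ha.le hb.le, hab, ENNReal.rpow_one]
    rw [this]
    exact ENNReal.mul_lt_mul (ENNReal.rpow_lt_rpow hx ha) (ENNReal.rpow_lt_rpow hy hb)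
  · have e1 : {x | ENNReal.ofReal t < f x} = ∅ := by
      ext x; simpa using (hf1 x).trans (not_lt.1 ht1)
    have e2 : {x | ENNReal.ofReal t < g x} = ∅ := by
      ext x; simpa using (hg1 x).trans (not_lt.1 ht1)
    simp [e1, e2]

lemma pl1_bdd (a b : ℝ) (ha : 0 < a) (hb : 0 < b) (hab : a + b = 1)
    (f g h : ℝ → ENNReal) (hf : Measurable f) (hg : Measurable g) (hh : Measurable h)
    (k l : ENNReal) (hk : k ≠ ⊤) (hl : l ≠ ⊤) (hf1 : ∀ x, f x ≤ k) (hg1 : ∀ x, g x ≤ l)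
    (H : ∀ x y, f x ^ a * g y ^ b ≤ h (a * x + b * y)) :
    (∫⁻ x, f x) ^ a * (∫⁻ x, g x) ^ b ≤ ∫⁻ x, h x := by
  set A := ⨆ x, f x with hA
  set B := ⨆ x, g x with hB
  have hAt : A ≠ ⊤ := ne_top_of_le_ne_top hk (iSup_le hf1)
  have hBt : B ≠ ⊤ := ne_top_of_le_ne_top hl (iSup_le hg1)
  by_cases hA0 : A = 0
  · have : ∀ x, f x = 0 := by simpa [hA] using hA0
    simp [this, ha]
  by_cases hB0 : B = 0
  · have : ∀ x, g x = 0 := by simpa [hB] using hB0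
    simp [this, hb]
  have hAa0 : A ^ a ≠ 0 := by simp [ENNReal.rpow_eq_zero_iff, hA0, hAt]
  have hBb0 : B ^ b ≠ 0 := by simp [ENNReal.rpow_eq_zero_iff, hB0, hBt]
  have hAat : A ^ a ≠ ⊤ := ENNReal.rpow_ne_top_of_nonneg ha.le hAt
  have hBbt : B ^ b ≠ ⊤ := ENNReal.rpow_ne_top_of_nonneg hb.le hBt
  have hn := pl1_norm a b ha hb hab (fun x => f x / A) (fun x => g x / B)
    (fun x => h x / (A ^ a * B ^ b)) (hf.div_const _) (hg.div_const _) (hh.div_const _)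
    (fun x => ENNReal.div_le_of_le_mul (by simpa using le_iSup f x))
    (fun x => ENNReal.div_le_of_le_mul (by simpa using le_iSup g x))
    (by
      intro t ht
      have : t * A < A := by
        simpa using (ENNReal.mul_lt_mul_iff_left hA0 hAt).2 ht
      obtain ⟨x, hx⟩ := lt_iSup_iff.1 this
      exact ⟨x, (ENNReal.lt_div_iff_mul_lt (Or.inl hA0) (Or.inl hAt)).2 hx⟩)
    (by
      intro t ht
      have : t * B < B := by
        simpa using (ENNReal.mul_lt_mul_iff_left hB0 hBt).2 ht
      obtain ⟨x, hx⟩ := lt_iSup_iff.1 this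
      exact ⟨x, (ENNReal.lt_div_iff_mul_lt (Or.inl hB0) (Or.inl hBt)).2 hx⟩)
    (by
      intro x y
      rw [ENNReal.div_rpow_of_nonneg _ _ ha.le, ENNReal.div_rpow_of_nonneg _ _ hb.le]
      rw [← ENNReal.mul_div_mul_comm (Or.inl hAa0) (Or.inl hAat)]
      gcongr
      exact H x y)
  have hn2 := (amgm_ennreal a b ha hb hab _ _).trans hn
  simp only [div_eq_mul_inv] at hn2
  rw [lintegral_mul_const _ hf, lintegral_mul_const _ hg, lintegral_mul_const _ hh] at hn2
  simp only [← div_eq_mul_inv] at hn2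
  rw [ENNReal.div_rpow_of_nonneg _ _ ha.le, ENNReal.div_rpow_of_nonneg _ _ hb.le] at hn2
  rw [← ENNReal.mul_div_mul_comm (Or.inl hAa0) (Or.inl hAat)] at hn2
  have h0 := mul_ne_zero hAa0 hBb0
  have ht := ENNReal.mul_ne_top hAat hBbt
  have := mul_le_mul_left hn2 (A ^ a * B ^ b)
  rwa [ENNReal.div_mul_cancel h0 ht, ENNReal.div_mul_cancel h0 ht] at this

/-- The Prekopa-Leindler property. -/
def PLprop (E : Type) [AddCommGroup E] [Module ℝ E] [MeasureSpace E] (a b : ℝ) : Prop :=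
  ∀ f g h : E → ENNReal, Measurable f → Measurable g → Measurable h →
    (∀ x y, f x ^ a * g y ^ b ≤ h (a • x + b • y)) →
    (∫⁻ x, f x) ^ a * (∫⁻ x, g x) ^ b ≤ ∫⁻ x, h x

lemma trunc_iSup (a : ℝ) (ha : 0 < a) (f : ℝ → ENNReal) (hf : Measurable f) :
    (∫⁻ x, f x) ^ a = ⨆ k : ℕ, (∫⁻ x, min (f x) k) ^ a := by
  have h1 : (∫⁻ x, f x) = ⨆ k : ℕ, ∫⁻ x, min (f x) k := by
    rw [← lintegral_iSup (fun k => hf.min measurable_const)]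
    · refine lintegral_congr fun x => ?_
      have := inf_iSup_eq (f x) (fun k : ℕ => (k : ENNReal))
      rw [ENNReal.iSup_natCast, inf_top_eq] at this
      exact this
    · intro i j hij x
      dsimp only
      gcongr
  rw [h1]
  exact (ENNReal.orderIsoRpow a ha).map_iSup _

lemma pl1 (a b : ℝ) (ha : 0 < a) (hb : 0 < b) (hab : a + b = 1) : PLprop ℝ a b := by
  intro f g h hf hg hh H
  rw [trunc_iSup a ha f hf, trunc_iSup b hb g hg, ENNReal.iSup_mul]
  refine iSup_le fun k => ?_
  rw [ENNReal.mul_iSup]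
  refine iSup_le fun l => ?_
  refine pl1_bdd a b ha hb hab (fun x => min (f x) k) (fun x => min (g x) l) h
    (hf.min measurable_const) (hg.min measurable_const) hh k l (by simp) (by simp)
    (fun x => min_le_right _ _) (fun x => min_le_right _ _) ?_
  intro x y
  refine le_trans ?_ (H x y)
  gcongr <;> exact min_le_left _ _

lemma pl_prod (E F : Type) [AddCommGroup E] [Module ℝ E] [MeasureSpace E]
    [AddCommGroup F] [Module ℝ F] [MeasureSpace F] [SFinite (volume : Measure E)]
    [SFinite (volume : Measure F)] (a b : ℝ)
    (hE : PLprop E a b) (hF : PLprop F a b) : PLprop (E × F) a b := by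
  intro f g h hf hg hh H
  rw [Measure.volume_eq_prod, lintegral_prod _ hf.aemeasurable, lintegral_prod _ hg.aemeasurable,
    lintegral_prod _ hh.aemeasurable]
  refine hE _ _ _ hf.lintegral_prod_right' hg.lintegral_prod_right' hh.lintegral_prod_right' ?_
  intro x y
  refine hF _ _ _ (hf.comp measurable_prodMk_left) (hg.comp measurable_prodMk_left)
    (hh.comp measurable_prodMk_left) ?_
  intro u v
  exact H (x, u) (y, v)

lemma pl_equiv (E F : Type) [AddCommGroup E] [Module ℝ E] [MeasureSpace E]
    [AddCommGroup F] [Module ℝ F] [MeasureSpace F] (a b : ℝ) (e : F ≃ᵐ E)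
    (he : MeasurePreserving e volume volume)
    (hl : ∀ x y, e (a • x + b • y) = a • e x + b • e y)
    (hF : PLprop F a b) : PLprop E a b := by
  intro f g h hf hg hh H
  rw [← he.lintegral_comp hf, ← he.lintegral_comp hg, ← he.lintegral_comp hh]
  refine hF _ _ _ (hf.comp e.measurable) (hg.comp e.measurable) (hh.comp e.measurable) ?_
  intro x y
  simp only [hl]
  exact H _ _

lemma pl_pi (a b : ℝ) (ha : 0 < a) (hb : 0 < b) (hab : a + b = 1) (m : ℕ) :
    PLprop (Fin m → ℝ) a b := by
  induction m with
  | zero =>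
    intro f g h hf hg hh H
    have := H 0 0
    simp only [Measure.volume_pi_eq_dirac (0 : Fin 0 → ℝ), lintegral_dirac]
    simpa using this
  | succ m ih =>
    refine pl_equiv _ (ℝ × (Fin m → ℝ)) a b
      (MeasurableEquiv.piFinSuccAbove (fun _ => ℝ) 0).symm
      ((volume_preserving_piFinSuccAbove (fun _ => ℝ) 0).symm _) ?_
      (pl_prod _ _ a b (pl1 a b ha hb hab) ih)
    intro x y
    ext i
    refine Fin.cases ?_ (fun j => ?_) i <;> simp [MeasurableEquiv.piFinSuccAbove]

lemma pl_euclid (a b : ℝ) (ha : 0 < a) (hb : 0 < b) (hab : a + b = 1) (m : ℕ) :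
    PLprop (EuclideanSpace ℝ (Fin m)) a b :=
  pl_equiv _ (Fin m → ℝ) a b (MeasurableEquiv.toLp 2 (Fin m → ℝ))
    (PiLp.volume_preserving_toLp _) (fun x y => by ext i; simp)
    (pl_pi a b ha hb hab m)

lemma slice_logconcave (m : ℕ) (K : Set (ℝ × EuclideanSpace ℝ (Fin m)))
    (hKcomp : IsCompact K) (hKconv : Convex ℝ K) (a b : ℝ) (ha : 0 < a) (hb : 0 < b)
    (hab : a + b = 1) (s t : ℝ) :
    (volume {y | (s, y) ∈ K}) ^ a * (volume {y | (t, y) ∈ K}) ^ b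
      ≤ volume {y | (a * s + b * t, y) ∈ K} := by
  have hm : ∀ s : ℝ, MeasurableSet {y | (s, y) ∈ K} := fun s =>
    measurable_prodMk_left hKcomp.measurableSet
  have := pl_euclid a b ha hb hab m ({y | (s, y) ∈ K}.indicator 1) ({y | (t, y) ∈ K}.indicator 1)
    ({y | (a * s + b * t, y) ∈ K}.indicator 1) (measurable_one.indicator (hm _))
    (measurable_one.indicator (hm _)) (measurable_one.indicator (hm _)) (by
      intro x y
      by_cases hx : (s, x) ∈ K
      · by_cases hy : (t, y) ∈ K
        · have hz : (a * s + b * t, a • x + b • y) ∈ K := hKconv hx hy ha.le hb.le hab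
          simp [hx, hy, hz]
        · simp [indicator, hy, hb]
      · simp [indicator, hx, ha])
  rwa [lintegral_indicator_one (hm _), lintegral_indicator_one (hm _),
    lintegral_indicator_one (hm _)] at this

/-- Supporting line of a log-concave function at the origin. -/
lemma exists_support (F : ℝ → ℝ)
    (hlc : ∀ a b : ℝ, 0 < a → 0 < b → a + b = 1 → ∀ s t, 0 < F s → 0 < F t →
      a * Real.log (F s) + b * Real.log (F t) ≤ Real.log (F (a * s + b * t)))
    (t1 t2 : ℝ) (h1 : t1 < 0) (h2 : 0 < t2) (hF1 : 0 < F t1) (hF2 : 0 < F t2) :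
    ∃ c : ℝ, ∀ t, 0 < F t → Real.log (F t) ≤ Real.log (F 0) + c * t := by
  have key : ∀ s t, s < 0 → 0 < t → 0 < F s → 0 < F t →
      (Real.log (F t) - Real.log (F 0)) / t ≤ (Real.log (F 0) - Real.log (F s)) / (-s) := by
    intro s t hs ht hFs hFt
    have hd : 0 < t - s := by linarith
    have := hlc (t / (t - s)) (-s / (t - s)) (by positivity)
      (div_pos (by linarith) hd) (by field_simp; ring) s t hFs hFt
    have e : t / (t - s) * s + -s / (t - s) * t = 0 := by field_simp; ring
    rw [e, div_mul_eq_mul_div, div_mul_eq_mul_div, ← add_div, div_le_iff₀ hd] at this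
    rw [div_le_div_iff₀ ht (by linarith)]
    nlinarith
  set S := {r | ∃ t, 0 < t ∧ 0 < F t ∧ r = (Real.log (F t) - Real.log (F 0)) / t} with hS
  have hbdd : BddAbove S := ⟨_, by
    rintro _ ⟨t, ht, hFt, rfl⟩; exact key t1 t h1 ht hF1 hFt⟩
  have hne : S.Nonempty := ⟨_, t2, h2, hF2, rfl⟩
  refine ⟨sSup S, fun t hFt => ?_⟩
  rcases lt_trichotomy t 0 with ht | ht | ht
  · have : sSup S ≤ (Real.log (F 0) - Real.log (F t)) / (-t) := csSup_le hne (by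
      rintro _ ⟨u, hu, hFu, rfl⟩; exact key t u ht hu hFt hFu)
    rw [le_div_iff₀ (by linarith)] at this
    linarith
  · simp [ht]
  · have : (Real.log (F t) - Real.log (F 0)) / t ≤ sSup S := le_csSup hbdd ⟨t, ht, hFt, rfl⟩
    rw [div_le_iff₀ ht] at this
    linarith

/-- A nonnegative log-concave density with maximum one and barycentre zero is at least `1/6`
at the origin. -/
lemma centroid_density (F : ℝ → ℝ) (hF0 : ∀ t, 0 ≤ F t)
    (hlc : ∀ a b : ℝ, 0 < a → 0 < b → a + b = 1 → ∀ s t,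
      F s ^ a * F t ^ b ≤ F (a * s + b * t))
    (x0 : ℝ) (hx0 : F x0 = 1) (hi : Integrable F) (hi1 : Integrable (fun t => t * F t))
    (hint : ∫ t, F t = 1) (hint1 : ∫ t, t * F t = 0) : 1 / 6 ≤ F 0 := by
  have hlog : ∀ a b : ℝ, 0 < a → 0 < b → a + b = 1 → ∀ s t, 0 < F s → 0 < F t →
      a * Real.log (F s) + b * Real.log (F t) ≤ Real.log (F (a * s + b * t)) := by
    intro a b ha hb hab s t hs ht
    have := Real.log_le_log (by positivity) (hlc a b ha hb hab s t)
    rwa [Real.log_mul (by positivity) (by positivity), Real.log_rpow hs, Real.log_rpow ht] at this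
  have hz : ¬ (∀ᵐ t : ℝ, t * F t = 0) := by
    intro h
    have h0 : ∀ᵐ t : ℝ, t ≠ 0 := by simp [ae_iff]
    have : F =ᵐ[volume] 0 := by
      filter_upwards [h, h0] with t h1 h2
      simpa [h2] using h1
    rw [integral_congr_ae this] at hint
    simp at hint
  obtain ⟨t2, h2, hF2⟩ : ∃ t, 0 < t ∧ 0 < F t := by
    by_contra! hc
    have hneg : ∀ t, 0 ≤ -(t * F t) := by
      intro t
      rcases le_or_gt t 0 with ht | ht
      · nlinarith [hF0 t]
      · nlinarith [hF0 t, hc t ht]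
    have := (integral_eq_zero_iff_of_nonneg (f := fun t => -(t * F t)) hneg hi1.neg).1
      (by rw [integral_neg, hint1, neg_zero])
    exact hz (by filter_upwards [this] with t ht; simpa using ht)
  obtain ⟨t1, h1, hF1⟩ : ∃ t, t < 0 ∧ 0 < F t := by
    by_contra! hc
    have hneg : ∀ t, 0 ≤ t * F t := by
      intro t
      rcases le_or_gt 0 t with ht | ht
      · nlinarith [hF0 t]
      · nlinarith [hF0 t, hc t ht]
    have := (integral_eq_zero_iff_of_nonneg (f := fun t => t * F t) hneg hi1).1 hint1
    exact hz (by filter_upwards [this] with t ht; simpa using ht)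
  obtain ⟨c, hc⟩ := exists_support F hlog t1 t2 h1 h2 hF1 hF2
  have hpos : 0 < F 0 := by
    have hd : 0 < t2 - t1 := by linarith
    have := hlc (t2 / (t2 - t1)) (-t1 / (t2 - t1)) (by positivity)
      (div_pos (by linarith) hd) (by field_simp; ring) t1 t2
    rw [show t2 / (t2 - t1) * t1 + -t1 / (t2 - t1) * t2 = 0 by field_simp; ring] at this
    exact lt_of_lt_of_le (by positivity) this
  have hpt : ∀ t, 4 * (F t - F (x0 / 4 + 3 / 4 * t)) ≤ Real.log (F 0) * F t + c * (t * F t) := by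
    intro t
    rcases (hF0 t).eq_or_lt with h | h
    · rw [← h]
      have := hF0 (x0 / 4 + 3 / 4 * t)
      linarith
    · have ha := hlc (1 / 4) (3 / 4) (by norm_num) (by norm_num) (by norm_num) x0 t
      rw [hx0, Real.one_rpow, one_mul, show 1 / 4 * x0 + 3 / 4 * t = x0 / 4 + 3 / 4 * t by ring] at ha
      have hb := hc t h
      have hl : 1 - F t ^ (-(1 / 4) : ℝ) ≤ Real.log (F t) / 4 := by
        have := Real.log_le_sub_one_of_pos (Real.rpow_pos_of_pos h (-(1 / 4)))
        rw [Real.log_rpow h] at this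
        linarith
      have he : F t * F t ^ (-(1 / 4) : ℝ) = F t ^ (3 / 4 : ℝ) := by
        nth_rewrite 1 [← Real.rpow_one (F t)]
        rw [← Real.rpow_add h]; norm_num
      have := mul_le_mul_of_nonneg_left (hl.trans (div_le_div_of_nonneg_right hb (by norm_num : (0:ℝ) ≤ 4))) h.le
      rw [mul_sub, he] at this
      linarith
  have hcomp : Integrable (fun t => F (x0 / 4 + 3 / 4 * t)) :=
    (hi.comp_add_left (x0 / 4)).comp_mul_left' (by norm_num : (3 / 4 : ℝ) ≠ 0)
  have hcompi : ∫ t, F (x0 / 4 + 3 / 4 * t) = 4 / 3 := by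
    rw [Measure.integral_comp_mul_left (fun u => F (x0 / 4 + u)) (3 / 4),
      integral_add_left_eq_self (fun u => F u) (x0 / 4), hint, abs_of_pos (by norm_num)]
    norm_num
  have hI := integral_mono (((hi.sub hcomp).const_mul 4)) ((hi.const_mul (Real.log (F 0))).add
    (hi1.const_mul c)) hpt
  simp only [Pi.add_apply, Pi.sub_apply] at hI
  rw [integral_const_mul, integral_sub hi hcomp, integral_add (hi.const_mul _) (hi1.const_mul _),
    integral_const_mul, integral_const_mul, hint, hint1, hcompi] at hI
  have hl6 : Real.log (1 / 6) ≤ -(4 / 3) := by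
    rw [one_div, Real.log_inv]
    have h6 : (4 / 3 : ℝ) ≤ Real.log 6 := by
      rw [Real.le_log_iff_exp_le (by norm_num)]
      have he := Real.exp_one_lt_d9
      have h3 : Real.exp (4 / 3) ^ 3 = Real.exp 1 ^ 4 := by
        rw [← Real.exp_nat_mul, ← Real.exp_nat_mul]; norm_num
      have h4 : Real.exp 1 ^ 4 ≤ 2.72 ^ 4 := by
        gcongr; linarith
      refine le_of_pow_le_pow_left₀ (n := 3) (by norm_num) (by norm_num) ?_
      rw [h3]; refine h4.trans ?_; norm_num
    linarith
  exact (Real.log_le_log_iff (by norm_num) hpos).1 (by linarith)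

end helpers

open MeasureTheory Set

theorem b_prime_le (n : ℕ) (hn : 2 ≤ n)
    (K : Set (ℝ × EuclideanSpace ℝ (Fin (n - 1))))
    (hKcomp : IsCompact K) (hKconv : Convex ℝ K)
    -- (H1): the centroid of K is the origin
    (hH1 : (∫ p in K, p) = 0)
    -- (H3): max_x |K_x| = 1
    (hH3le : ∀ x : ℝ, volume {y : EuclideanSpace ℝ (Fin (n - 1)) | (x, y) ∈ K} ≤ 1)
    (hH3eq : ∃ x : ℝ, volume {y : EuclideanSpace ℝ (Fin (n - 1)) | (x, y) ∈ K} = 1)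
    -- (H4): |K| = 1
    (hH4 : volume K = 1)
    (b' : ℝ)
    (hb' : b' = ((n:ℝ) / (volume {y : EuclideanSpace ℝ (Fin (n - 1)) | ((0:ℝ), y) ∈ K}).toReal)
            * (volume (K ∩ {p : ℝ × EuclideanSpace ℝ (Fin (n - 1)) | 0 ≤ p.1})).toReal) :
    b' ≤ 3 * (n:ℝ) ^ 2 := by
  set F : ℝ → ℝ := fun x =>
    (volume {y : EuclideanSpace ℝ (Fin (n - 1)) | (x, y) ∈ K}).toReal with hF
  have hKm := hKcomp.measurableSet
  have hfin : ∀ x : ℝ, volume {y : EuclideanSpace ℝ (Fin (n - 1)) | (x, y) ∈ K} ≠ ⊤ := fun x =>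
    ne_top_of_le_ne_top ENNReal.one_ne_top (hH3le x)
  have hsm : ∀ x : ℝ, MeasurableSet {y : EuclideanSpace ℝ (Fin (n - 1)) | (x, y) ∈ K} :=
    fun x => measurable_prodMk_left hKm
  have hlc : ∀ a b : ℝ, 0 < a → 0 < b → a + b = 1 → ∀ s t,
      F s ^ a * F t ^ b ≤ F (a * s + b * t) := by
    intro a b ha hb hab s t
    have := ENNReal.toReal_mono (hfin _)
      (slice_logconcave (n - 1) K hKcomp hKconv a b ha hb hab s t)
    rwa [ENNReal.toReal_mul, ← ENNReal.toReal_rpow, ← ENNReal.toReal_rpow] at this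
  have hconv : ∀ u : ℝ → ℝ, Continuous u →
      Integrable (fun t => u t * F t) ∧ ∫ t, u t * F t = ∫ p in K, u p.1 := by
    intro u hu
    have hI : Integrable (K.indicator fun p => u p.1)
        ((volume : Measure ℝ).prod (volume : Measure (EuclideanSpace ℝ (Fin (n - 1))))) := by
      rw [integrable_indicator_iff hKm]
      exact (hu.comp continuous_fst).continuousOn.integrableOn_compact hKcomp
    have he : ∀ t, ∫ y, K.indicator (fun p => u p.1) (t, y) = u t * F t := by
      intro t
      have : (fun y => K.indicator (fun p => u p.1) (t, y)) =
          {y : EuclideanSpace ℝ (Fin (n - 1)) | (t, y) ∈ K}.indicator (fun _ => u t) := by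
        ext y; simp [indicator]
      rw [this, integral_indicator_const _ (hsm t), smul_eq_mul, mul_comm]
      rfl
    constructor
    · have := hI.integral_prod_left
      simpa only [he] using this
    · rw [← integral_indicator hKm, Measure.volume_eq_prod, integral_prod _ hI]
      simp only [he]
  obtain ⟨hi, hint⟩ := hconv (fun _ => 1) continuous_const
  obtain ⟨hi1, hint1⟩ := hconv (fun t => t) continuous_id
  simp only [one_mul] at hi hint
  have hid : IntegrableOn (fun p : ℝ × EuclideanSpace ℝ (Fin (n - 1)) => p) K :=
    continuous_id.continuousOn.integrableOn_compact hKcomp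
  have hfst : ∫ p in K, p.1 = 0 := by
    have := (ContinuousLinearMap.fst ℝ ℝ (EuclideanSpace ℝ (Fin (n - 1)))).integral_comp_comm hid
    rw [hH1] at this
    simpa using this
  obtain ⟨x0, hx0⟩ := hH3eq
  have h6 : 1 / 6 ≤ F 0 := centroid_density F (fun t => ENNReal.toReal_nonneg) hlc x0
    (by simp [hF, hx0]) hi hi1 (by rw [hint]; simp [Measure.real, hH4]) (by rw [hint1, hfst])
  have hV : (volume (K ∩ {p : ℝ × EuclideanSpace ℝ (Fin (n - 1)) | 0 ≤ p.1})).toReal ≤ 1 := by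
    have := ENNReal.toReal_mono (by simp [hH4]) (measure_mono (μ := volume)
      (inter_subset_left : K ∩ {p : ℝ × EuclideanSpace ℝ (Fin (n - 1)) | 0 ≤ p.1} ⊆ K))
    simpa [hH4] using this
  have hn2 : (2 : ℝ) ≤ n := by exact_mod_cast hn
  have hd : (n : ℝ) / F 0 ≤ 6 * n := by
    rw [div_le_iff₀ (by linarith)]
    nlinarith
  rw [hb']
  calc (n : ℝ) / F 0 * _ ≤ 6 * n * 1 := by
        apply mul_le_mul hd hV ENNReal.toReal_nonneg (by linarith)
    _ ≤ 3 * (n : ℝ) ^ 2 := by nlinarith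
end
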